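/- In every reachable state of every execution of the BWBGME algorithm, no two processes that request different sessions are in the critical section at the same time (the Mutual Exclusion property holds). -/

import Mathlib

/-! ## Model of the Black and White Bakery GME (BWBGME) algorithm -/

inductive Color : Type
  | black
  | white
  deriving DecidableEq

/-- The opposite color. -/
def Color.opp : Color → Color
  | .black => .white
  | .white => .black

/-- A token: a session number, a color in {black, white, ⊥} (`none` is ⊥) and a
token number. -/
structure BWTok where
  session : ℕ
  color : Option Color
  number : ℕ
  deriving DecidableEq

def BWTok.init : BWTok := ⟨0, none, 0⟩

/-- Program counter of a process in the BWBGME algorithm.  The doorway is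
`d1 s` (Token[i]:=(s,⊥,0)), `d2 s` (Choosing[i]:=true, line 4),
`d3 s` (mycolor:=GlobalColor, line 5), `scan s c j m` (the loop computing the max `m`
of the token numbers of conflicting processes with token color `c`; `j` is the next
index to read), `d4 s c m` (Token[i]:=(s,c,m), where `m` is the final mynumber) and
`d5 s c m` (Choosing[i]:=false).  The waiting room iterates, for each `j`:
`w1` (wait until Choosing[j]=false or Token[j].session=s), `wB` (the branch reading
Token[j].color), and the busy-waits `wSame` / `wDiff`.  The exit section is the scan
`x1 s c m j` looking for an active process of the opposite color (entered only when
`m ≠ 1`), `xFlip s c m` (GlobalColor := opposite of `c`) and `x2` (Token[i]:=(0,⊥,0)). -/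
inductive BWPc : Type
  | remainder
  | d1 (s : ℕ)
  | d2 (s : ℕ)
  | d3 (s : ℕ)
  | scan (s : ℕ) (c : Color) (j : ℕ) (m : ℕ)
  | d4 (s : ℕ) (c : Color) (m : ℕ)
  | d5 (s : ℕ) (c : Color) (m : ℕ)
  | w1 (s : ℕ) (c : Color) (m : ℕ) (j : ℕ)
  | wB (s : ℕ) (c : Color) (m : ℕ) (j : ℕ)
  | wSame (s : ℕ) (c : Color) (m : ℕ) (j : ℕ)
  | wDiff (s : ℕ) (c : Color) (m : ℕ) (j : ℕ)
  | cs (s : ℕ) (c : Color) (m : ℕ)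
  | x1 (s : ℕ) (c : Color) (m : ℕ) (j : ℕ)
  | xFlip (s : ℕ) (c : Color) (m : ℕ)
  | x2
  deriving DecidableEq

/-- Global state: GlobalColor, the shared arrays Token and Choosing, and the
control state of each process. -/
structure BWState (N : ℕ) where
  gcolor : Color
  token : Fin N → BWTok
  choosing : Fin N → Bool
  pc : Fin N → BWPc

/-- Initial state; GlobalColor is initialized arbitrarily to `c0`. -/
def bwInit (N : ℕ) (c0 : Color) : BWState N :=
  { gcolor := c0, token := fun _ => BWTok.init, choosing := fun _ => false,
    pc := fun _ => BWPc.remainder }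

/-- One atomic step of process `i` of the BWBGME algorithm. -/
def bwStep {N : ℕ} (st : BWState N) (i : Fin N) (st' : BWState N) : Prop :=
  match st.pc i with
  | .remainder =>
      st' = st ∨ ∃ s : ℕ, 0 < s ∧ st' = { st with pc := Function.update st.pc i (.d1 s) }
  | .d1 s =>
      st' = { st with token := Function.update st.token i ⟨s, none, 0⟩,
                      pc := Function.update st.pc i (.d2 s) }
  | .d2 s =>
      st' = { st with choosing := Function.update st.choosing i true,
                      pc := Function.update st.pc i (.d3 s) }
  | .d3 s =>
      st' = { st with pc := Function.update st.pc i (.scan s st.gcolor 0 0) }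
  | .scan s c j m =>
      if h : j < N then
        st' = { st with pc := Function.update st.pc i (.scan s c (j+1)
                  (if (st.token ⟨j, h⟩).color = some c ∧ (st.token ⟨j, h⟩).session ≠ 0 ∧
                      (st.token ⟨j, h⟩).session ≠ s
                   then max m (st.token ⟨j, h⟩).number else m)) }
      else
        st' = { st with pc := Function.update st.pc i (.d4 s c (m+1)) }
  | .d4 s c m =>
      st' = { st with token := Function.update st.token i ⟨s, some c, m⟩,
                      pc := Function.update st.pc i (.d5 s c m) }
  | .d5 s c m =>
      st' = { st with choosing := Function.update st.choosing i false,
                      pc := Function.update st.pc i (.w1 s c m 0) }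
  | .w1 s c m j =>
      if h : j < N then
        if st.choosing ⟨j, h⟩ = false ∨ (st.token ⟨j, h⟩).session = s then
          st' = { st with pc := Function.update st.pc i (.wB s c m j) }
        else st' = st
      else
        st' = { st with pc := Function.update st.pc i (.cs s c m) }
  | .wB s c m j =>
      if h : j < N then
        if (st.token ⟨j, h⟩).color = some c then
          st' = { st with pc := Function.update st.pc i (.wSame s c m j) }
        else
          st' = { st with pc := Function.update st.pc i (.wDiff s c m j) }
      else st' = st
  | .wSame s c m j =>
      if h : j < N then
        if (m < (st.token ⟨j, h⟩).number ∨ (m = (st.token ⟨j, h⟩).number ∧ i.val < j)) ∨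
            (st.token ⟨j, h⟩).color ≠ some c ∨ (st.token ⟨j, h⟩).session = 0 ∨
            (st.token ⟨j, h⟩).session = s then
          st' = { st with pc := Function.update st.pc i (.w1 s c m (j+1)) }
        else st' = st
      else st' = st
  | .wDiff s c m j =>
      if h : j < N then
        if st.gcolor ≠ c ∨ (st.token ⟨j, h⟩).color = some c ∨
            (st.token ⟨j, h⟩).session = 0 ∨ (st.token ⟨j, h⟩).session = s then
          st' = { st with pc := Function.update st.pc i (.w1 s c m (j+1)) }
        else st' = st
      else st' = st
  | .cs s c m =>
      st' = st ∨
        st' = { st with pc :=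
                  Function.update st.pc i (if m = 1 then BWPc.x2 else BWPc.x1 s c m 0) }
  | .x1 s c m j =>
      if h : j < N then
        if (st.token ⟨j, h⟩).session ≠ 0 ∧ (st.token ⟨j, h⟩).color = some c.opp then
          st' = { st with pc := Function.update st.pc i .x2 }
        else
          st' = { st with pc := Function.update st.pc i (.x1 s c m (j+1)) }
      else
        st' = { st with pc := Function.update st.pc i (.xFlip s c m) }
  | .xFlip _ c _ =>
      st' = { st with gcolor := c.opp, pc := Function.update st.pc i .x2 }
  | .x2 =>
      st' = { st with token := Function.update st.token i BWTok.init,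
                      pc := Function.update st.pc i .remainder }

/-- An execution of the BWBGME algorithm: an interleaving of atomic steps from an
initial state (with arbitrary GlobalColor) in which every process outside its
remainder section eventually takes its next step. -/
structure BWExec (N : ℕ) where
  state : ℕ → BWState N
  sched : ℕ → Fin N
  init : ∃ c0, state 0 = bwInit N c0
  step : ∀ n, bwStep (state n) (sched n) (state (n + 1))
  fair : ∀ (i : Fin N) (n : ℕ), (state n).pc i ≠ BWPc.remainder →
           ∃ m, n ≤ m ∧ sched m = i

/-- Process `i` is in the critical section. -/
def bwInCS {N : ℕ} (st : BWState N) (i : Fin N) : Prop :=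
  ∃ s c m, st.pc i = BWPc.cs s c m

/-- Process `i` is in the entry section (doorway or waiting room). -/
def bwInEntry {N : ℕ} (st : BWState N) (i : Fin N) : Prop :=
  match st.pc i with
  | .remainder => False
  | .cs _ _ _ => False
  | .x1 _ _ _ _ => False
  | .xFlip _ _ _ => False
  | .x2 => False
  | _ => True

/-- At step `n`, process `i` leaves the remainder and enters the doorway,
requesting session `s`. -/
def bwEntersDoorway {N : ℕ} (e : BWExec N) (i : Fin N) (s : ℕ) (n : ℕ) : Prop :=
  (e.state n).pc i = BWPc.remainder ∧ (e.state (n+1)).pc i = BWPc.d1 s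

/-- At step `n`, process `i` completes its doorway (executes Choosing[i]:=false),
having requested session `s` and chosen token color `c` and token number `m`. -/
def bwCompletesDoorway {N : ℕ} (e : BWExec N) (i : Fin N) (s : ℕ) (c : Color) (m : ℕ)
    (n : ℕ) : Prop :=
  (e.state n).pc i = BWPc.d5 s c m ∧ (e.state (n+1)).pc i = BWPc.w1 s c m 0

/-- At step `n`, process `i` executes line 5, reading GlobalColor = `c`
(its invocation requests session `s`). -/
def bwLine5 {N : ℕ} (e : BWExec N) (i : Fin N) (s : ℕ) (c : Color) (n : ℕ) : Prop :=
  (e.state n).pc i = BWPc.d3 s ∧ (e.state (n+1)).pc i = BWPc.scan s c 0 0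

/-- At step `n`, process `i` executes line 4 (Choosing[i]:=true). -/
def bwLine4 {N : ℕ} (e : BWExec N) (i : Fin N) (s : ℕ) (n : ℕ) : Prop :=
  (e.state n).pc i = BWPc.d2 s ∧ (e.state (n+1)).pc i = BWPc.d3 s

/-- At step `n`, process `i` enters the critical section. -/
def bwEntersCS {N : ℕ} (e : BWExec N) (i : Fin N) (n : ℕ) : Prop :=
  ¬ bwInCS (e.state n) i ∧ bwInCS (e.state (n+1)) i

/-- At step `n`, process `i` finishes (leaves) the critical section. -/
def bwLeavesCS {N : ℕ} (e : BWExec N) (i : Fin N) (n : ℕ) : Prop :=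
  bwInCS (e.state n) i ∧ ¬ bwInCS (e.state (n+1)) i

/-- At step `n`, process `i` completes its exit section
(executes Token[i]:=(0,⊥,0) and returns to the remainder section). -/
def bwCompletesExit {N : ℕ} (e : BWExec N) (i : Fin N) (n : ℕ) : Prop :=
  (e.state n).pc i = BWPc.x2 ∧ (e.state (n+1)).pc i = BWPc.remainder

/-- Process `i` does not pass through the remainder section during `(a, b]`
(so times `a` and `b` belong to the same invocation of `i`). -/
def bwActiveThrough {N : ℕ} (e : BWExec N) (i : Fin N) (a b : ℕ) : Prop :=
  ∀ k, a < k → k ≤ b → (e.state k).pc i ≠ BWPc.remainder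

/-- GlobalColor is flipped at step `n`: the step is a write that changes its value. -/
def bwFlipAt {N : ℕ} (e : BWExec N) (n : ℕ) : Prop :=
  (e.state (n+1)).gcolor ≠ (e.state n).gcolor

namespace BWPc

/-- The color a process has read from GlobalColor but not yet published in its token. -/
def pick : BWPc → Option Color
  | scan _ c _ _ => some c
  | d4 _ c _ => some c
  | _ => none

/-- The process has seen process `j` not choosing (or with its own session) in the waiting room. -/
def Checked : BWPc → ℕ → Prop
  | w1 _ _ _ k, j => j < k
  | wB _ _ _ k, j => j ≤ k
  | wSame _ _ _ k, j => j ≤ k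
  | wDiff _ _ _ k, j => j ≤ k
  | cs _ _ _, _ => True
  | x1 _ _ _ _, _ => True
  | xFlip _ _ _, _ => True
  | x2, _ => True
  | _, _ => False

/-- The process no longer waits for a process `j` whose token has the opposite color. -/
def PassedDiff : BWPc → ℕ → Prop
  | w1 _ _ _ k, j => j < k
  | wB _ _ _ k, j => j < k
  | wSame _ _ _ k, j => j ≤ k
  | wDiff _ _ _ k, j => j < k
  | cs _ _ _, _ => True
  | x1 _ _ _ _, _ => True
  | xFlip _ _ _, _ => True
  | x2, _ => True
  | _, _ => False

/-- The process no longer waits for a process `j` whose token has the same color. -/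
def PassedSame : BWPc → ℕ → Prop
  | w1 _ _ _ k, j => j < k
  | wB _ _ _ k, j => j < k
  | wSame _ _ _ k, j => j < k
  | wDiff _ _ _ k, j => j ≤ k
  | cs _ _ _, _ => True
  | x1 _ _ _ _, _ => True
  | xFlip _ _ _, _ => True
  | x2, _ => True
  | _, _ => False

/-- The number the process is about to publish accounts for the number `m` of process `i`
(once its scan is past `i`). -/
def Accounts : BWPc → ℕ → ℕ → Prop
  | scan _ _ k a, i, m => i < k → m ≤ a
  | d4 _ _ a, _, m => m < a
  | _, _, _ => True

/-- The maximal conflicting token number seen in the doorway. -/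
def seen : BWPc → BWTok → ℕ
  | scan _ _ _ a, _ => a
  | d4 _ _ a, _ => a - 1
  | _, t => t.number - 1

/-- The values of the token and of the choosing bit which the control state determines. -/
def Local : BWPc → BWTok → Bool → Prop
  | remainder, t, b => t = BWTok.init ∧ b = false
  | d1 s, t, b => 0 < s ∧ t = BWTok.init ∧ b = false
  | d2 s, t, b => 0 < s ∧ t = ⟨s, none, 0⟩ ∧ b = false
  | d3 s, t, b => 0 < s ∧ t = ⟨s, none, 0⟩ ∧ b = true
  | scan s _ _ _, t, b => 0 < s ∧ t = ⟨s, none, 0⟩ ∧ b = true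
  | d4 s _ m, t, b => 0 < s ∧ t = ⟨s, none, 0⟩ ∧ b = true ∧ 0 < m
  | d5 s c m, t, b => 0 < s ∧ t = ⟨s, some c, m⟩ ∧ b = true ∧ 0 < m
  | w1 s c m _, t, b => 0 < s ∧ t = ⟨s, some c, m⟩ ∧ b = false ∧ 0 < m
  | wB s c m _, t, b => 0 < s ∧ t = ⟨s, some c, m⟩ ∧ b = false ∧ 0 < m
  | wSame s c m _, t, b => 0 < s ∧ t = ⟨s, some c, m⟩ ∧ b = false ∧ 0 < m
  | wDiff s c m _, t, b => 0 < s ∧ t = ⟨s, some c, m⟩ ∧ b = false ∧ 0 < m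
  | cs s c m, t, b => 0 < s ∧ t = ⟨s, some c, m⟩ ∧ b = false ∧ 0 < m
  | x1 s c m _, t, b => 0 < s ∧ t = ⟨s, some c, m⟩ ∧ b = false ∧ 2 ≤ m
  | xFlip s c m, t, b => 0 < s ∧ t = ⟨s, some c, m⟩ ∧ b = false ∧ 2 ≤ m
  | x2, t, b => 0 < t.session ∧ t.color ≠ none ∧ b = false

theorem PassedDiff.checked {pc : BWPc} {j : ℕ} (h : pc.PassedDiff j) :
    pc.Checked j := by
  cases pc <;> simp_all [BWPc.PassedDiff, BWPc.Checked] <;> omega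

theorem PassedSame.checked {pc : BWPc} {j : ℕ} (h : pc.PassedSame j) :
    pc.Checked j := by
  cases pc <;> simp_all [BWPc.PassedSame, BWPc.Checked] <;> omega

theorem Local.pick_eq_none_of_not_choosing {pc : BWPc} {t : BWTok} {b : Bool}
    (h : pc.Local t b) (hb : b = false) : pc.pick = none := by
  cases pc <;> simp_all [BWPc.Local, BWPc.pick]

theorem Local.session_ne_zero_of_color {pc : BWPc} {t : BWTok} {b : Bool}
    (h : pc.Local t b) (hc : t.color ≠ none) : t.session ≠ 0 := by
  cases pc <;> simp_all [BWPc.Local, BWTok.init] <;> omega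

end BWPc

namespace BWState

variable {N : ℕ}

/-- Process `i` has the color `c`, published in its token or not. -/
def HasColor (st : BWState N) (i : Fin N) (c : Color) : Prop :=
  (st.pc i).pick = some c ∨ (st.token i).color = some c

/-- The precedence of `i` over a conflicting process `j` which `i` has checked or passed. -/
structure Precedes (st : BWState N) (i j : Fin N) : Prop where
  pick_diff : (st.pc i).Checked j → (st.token i).session ≠ (st.token j).session →
    ∀ c c', (st.token i).color = some c → (st.pc j).pick = some c' → c ≠ c' → st.gcolor ≠ c
  pick_same : (st.pc i).Checked j → (st.token i).session ≠ (st.token j).session →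
    ∀ c, (st.token i).color = some c → (st.pc j).pick = some c →
      (st.pc j).Accounts i (st.token i).number
  token_diff : (st.pc i).PassedDiff j → (st.token i).session ≠ (st.token j).session →
    ∀ c c', (st.token i).color = some c → (st.token j).color = some c' → c ≠ c' → st.gcolor ≠ c
  token_same : (st.pc i).PassedSame j → (st.token i).session ≠ (st.token j).session →
    ∀ c, (st.token i).color = some c → (st.token j).color = some c →
      (st.token i).number < (st.token j).number ∨
        (st.token i).number = (st.token j).number ∧ i.val < j.val

/-- If `k` has the global color and has seen a conflicting token, and `i` has the same session and
the other color, then a process conflicting with both is still ahead of `k`. -/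
def HasBlocker (st : BWState N) : Prop :=
  ∀ k i c, st.HasColor k st.gcolor → st.HasColor i c → c ≠ st.gcolor →
    (st.token i).session = (st.token k).session → 1 ≤ (st.pc k).seen (st.token k) →
    ∃ l, (st.token l).color = some st.gcolor ∧ (st.token l).session ≠ (st.token k).session ∧
      (st.token l).number ≤ (st.pc k).seen (st.token k)

/-- The inductive invariant of the BWBGME algorithm. -/
structure Inv (st : BWState N) : Prop where
  loc : ∀ i, (st.pc i).Local (st.token i) (st.choosing i)
  prec : ∀ i j, st.Precedes i j
  blocker : st.HasBlocker

theorem inv_bwInit (c : Color) : (bwInit N c).Inv where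
  loc _ := ⟨rfl, rfl⟩
  prec _ _ := by constructor <;> simp [bwInit, BWPc.Checked, BWPc.PassedDiff, BWPc.PassedSame]
  blocker k _ _ hk := by simp [HasColor, bwInit, BWPc.pick, BWTok.init] at hk

theorem Precedes.self (st : BWState N) (i : Fin N) : st.Precedes i i := by
  constructor <;> exact fun _ h => absurd rfl h

theorem Precedes.congr {st st' : BWState N} {i j : Fin N} (h : st.Precedes i j)
    (hg : st'.gcolor = st.gcolor) (hi : st'.pc i = st.pc i) (hj : st'.pc j = st.pc j)
    (hti : st'.token i = st.token i) (htj : st'.token j = st.token j) : st'.Precedes i j := by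
  constructor <;> rw [hi, hti, htj] <;> (try rw [hj]) <;> (try rw [hg])
  exacts [h.pick_diff, h.pick_same, h.token_diff, h.token_same]

/-- A step of `p` that does not change GlobalColor preserves the invariant if it preserves the
parts that concern `p`. -/
theorem Inv.of_local {st st' : BWState N} (h : st.Inv) (p : Fin N)
    (hg : st'.gcolor = st.gcolor)
    (hq : ∀ q, q ≠ p → st'.pc q = st.pc q ∧ st'.token q = st.token q ∧
      st'.choosing q = st.choosing q)
    (hl : (st'.pc p).Local (st'.token p) (st'.choosing p))
    (hp : ∀ q, q ≠ p → st'.Precedes p q ∧ st'.Precedes q p)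
    (hb : st'.HasBlocker) : st'.Inv where
  loc i := by
    by_cases hi : i = p
    · exact hi ▸ hl
    · obtain ⟨h1, h2, h3⟩ := hq i hi
      rw [h1, h2, h3]
      exact h.loc i
  prec i j := by
    by_cases hi : i = p
    · by_cases hj : j = p
      · rw [hi, hj]
        exact .self st' p
      · exact hi ▸ (hp j hj).1
    · by_cases hj : j = p
      · exact hj ▸ (hp i hi).2
      · exact (h.prec i j).congr hg (hq i hi).1 (hq j hj).1 (hq i hi).2.1 (hq j hj).2.1
  blocker := hb

/-- `HasBlocker` is preserved by steps that change neither colors, sessions nor numbers seen,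
and do not withdraw tokens. -/
theorem HasBlocker.congr {st st' : BWState N} (h : st.HasBlocker) (hg : st'.gcolor = st.gcolor)
    (hc : ∀ q c, st'.HasColor q c → st.HasColor q c)
    (hs : ∀ q c, st'.HasColor q c → (st'.token q).session = (st.token q).session)
    (he : ∀ q c, st'.HasColor q c → (st'.pc q).seen (st'.token q) = (st.pc q).seen (st.token q))
    (ht : ∀ q c, (st.token q).color = some c → st'.token q = st.token q) : st'.HasBlocker := by
  intro k i c hk hi hci hsi h1
  rw [hs _ _ hk, hs _ _ hi] at hsi
  rw [he _ _ hk] at h1 ⊢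
  rw [hs _ _ hk]
  rw [hg] at hk hci
  obtain ⟨l, hl1, hl2, hl3⟩ := h k i c (hc _ _ hk) (hc _ _ hi) hci hsi h1
  refine ⟨l, ?_, ?_, ?_⟩
  · rw [ht l _ hl1, hl1, hg]
  · rwa [ht l _ hl1]
  · rwa [ht l _ hl1]

/-- A process that has passed everyone and whose color is the global one and whose number is not
`1` leaves no process with the opposite color. -/
theorem Inv.hasColor_eq {st : BWState N} (h : st.Inv) {p : Fin N}
    (hd : ∀ q : Fin N, (st.pc p).PassedDiff q) (hsm : ∀ q : Fin N, (st.pc p).PassedSame q)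
    (hck : ∀ q : Fin N, (st.pc p).Checked q) (hc : (st.token p).color = some st.gcolor)
    (hseen : (st.pc p).seen (st.token p) = (st.token p).number - 1)
    (hm : 2 ≤ (st.token p).number) {i : Fin N} {c : Color} (hi : st.HasColor i c) :
    c = st.gcolor := by
  by_contra hne
  by_cases hs : (st.token p).session = (st.token i).session
  · obtain ⟨l, hl1, hl2, hl3⟩ := h.blocker p i c (Or.inr hc) hi hne hs.symm (by omega)
    have := (h.prec p l).token_same (hsm l) (Ne.symm hl2) _ hc hl1
    omega
  · rcases hi with hi | hi
    · exact (h.prec p i).pick_diff (hck i) hs _ _ hc hi (Ne.symm hne) rfl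
    · exact (h.prec p i).token_diff (hd i) hs _ _ hc hi (Ne.symm hne) rfl

/-- A step that only changes the control state of `p`, where `p` does not publish or forget a
color. -/
theorem Inv.of_pc {st : BWState N} (h : st.Inv) (p : Fin N) (pc' : BWPc)
    (hl : pc'.Local (st.token p) (st.choosing p))
    (hpick : pc'.pick = (st.pc p).pick)
    (hacc : ∀ i m, (st.pc p).Accounts i m → pc'.Accounts i m)
    (hseen : pc'.seen (st.token p) = (st.pc p).seen (st.token p))
    (hck : ∀ q : Fin N, pc'.Checked q → (st.pc p).Checked q ∨
      ((st.token p).session ≠ (st.token q).session → (st.pc q).pick = none))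
    (hpd : ∀ q : Fin N, pc'.PassedDiff q → (st.pc p).PassedDiff q ∨
      ((st.token p).session ≠ (st.token q).session → ∀ c c', (st.token p).color = some c →
        (st.token q).color = some c' → c ≠ c' → st.gcolor ≠ c))
    (hps : ∀ q : Fin N, pc'.PassedSame q → (st.pc p).PassedSame q ∨
      ((st.token p).session ≠ (st.token q).session → ∀ c, (st.token p).color = some c →
        (st.token q).color = some c → (st.token p).number < (st.token q).number ∨
          (st.token p).number = (st.token q).number ∧ p.val < q.val)) :
    ({ st with pc := Function.update st.pc p pc' } : BWState N).Inv := by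
  refine h.of_local p rfl ?_ ?_ ?_ ?_
  · intro q hq
    simp [hq]
  · simpa using hl
  · intro q hq
    constructor
    · obtain ⟨h1, h2, h3, h4⟩ := h.prec p q
      constructor <;> simp only [ne_eq, hq, not_false_eq_true, Function.update_of_ne,
        Function.update_self]
      · intro a b c c' hc hc'
        rcases hck q a with h | h
        · exact h1 h b c c' hc hc'
        · simp [h b] at hc'
      · intro a b c hc hc'
        rcases hck q a with h | h
        · exact h2 h b c hc hc'
        · simp [h b] at hc'
      · intro a
        exact (hpd q a).elim h3 id
      · intro a
        exact (hps q a).elim h4 id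
    · obtain ⟨h1, h2, h3, h4⟩ := h.prec q p
      constructor <;> simp only [ne_eq, hq, not_false_eq_true, Function.update_of_ne,
        Function.update_self, hpick]
      · exact h1
      · exact fun a b c d e => hacc _ _ (h2 a b c d e)
      · exact h3
      · exact h4
  · refine h.blocker.congr rfl ?_ (fun _ _ _ => rfl) ?_ (fun _ _ _ => rfl)
    · intro q c
      by_cases hq : q = p
      · subst hq
        simp [HasColor, hpick]
      · simp [HasColor, hq]
    · intro q _ _
      by_cases hq : q = p
      · subst hq
        simpa using hseen
      · simp [hq]

/-- If all colors in use agree, then GlobalColor may change. -/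
theorem Inv.of_gcolor {st : BWState N} (h : st.Inv) (d g : Color)
    (hd : ∀ i c, st.HasColor i c → c = d) : ({ st with gcolor := g } : BWState N).Inv where
  loc := h.loc
  prec i j :=
    { pick_diff := fun _ _ c c' hc hc' hne =>
        absurd ((hd i c (.inr hc)).trans (hd j c' (.inl hc')).symm) hne
      pick_same := (h.prec i j).pick_same
      token_diff := fun _ _ c c' hc hc' hne =>
        absurd ((hd i c (.inr hc)).trans (hd j c' (.inr hc')).symm) hne
      token_same := (h.prec i j).token_same }
  blocker k i c hk hi hc := absurd ((hd i c hi).trans (hd k g hk).symm) hc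

theorem Inv.step {st st' : BWState N} (h : st.Inv) {p : Fin N} (hst : bwStep st p st') :
    st'.Inv := by
  have hl := h.loc p
  have hp := h.prec p
  unfold bwStep at hst
  split at hst
  case h_1 hpc =>
    rw [hpc] at hl
    simp only [BWPc.Local] at hl
    rcases hst with rfl | ⟨s, hs, rfl⟩
    · exact h
    · exact h.of_pc p _ ⟨hs, hl⟩ (by rw [hpc]; rfl) (by simp [BWPc.Accounts]) (by rw [hpc]; rfl)
        (by simp [BWPc.Checked]) (by simp [BWPc.PassedDiff]) (by simp [BWPc.PassedSame])
  case h_2 s hpc =>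
    rw [hpc] at hl
    obtain ⟨l1, l2, l3⟩ := hl
    subst hst
    refine h.of_local p rfl (fun q hq => by simp [hq]) (by simp [BWPc.Local, l1, l3])
      (fun q hq => ⟨?_, ?_⟩) ?_
    · constructor <;> simp [BWPc.Checked, BWPc.PassedDiff, BWPc.PassedSame]
    · constructor <;> simp [hq, BWPc.pick]
    · refine h.blocker.congr rfl ?_ ?_ ?_ ?_ <;> intro q <;> by_cases hq : q = p <;>
        simp_all [HasColor, BWPc.pick, BWTok.init]
  case h_3 s hpc =>
    rw [hpc] at hl
    obtain ⟨l1, l2, l3⟩ := hl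
    subst hst
    refine h.of_local p rfl (fun q hq => by simp [hq]) (by simp [BWPc.Local, l1, l2])
      (fun q hq => ⟨?_, ?_⟩) ?_
    · constructor <;> simp [BWPc.Checked, BWPc.PassedDiff, BWPc.PassedSame]
    · constructor <;> simp [hq, BWPc.pick, l2]
    · refine h.blocker.congr rfl ?_ ?_ ?_ ?_ <;> intro q <;> by_cases hq : q = p <;>
        simp_all [HasColor, BWPc.pick]
  case h_4 s hpc =>
    rw [hpc] at hl
    obtain ⟨l1, l2, l3⟩ := hl
    subst hst
    refine h.of_local p rfl (fun q hq => by simp [hq]) (by simp [BWPc.Local, l1, l2, l3])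
      (fun q hq => ⟨?_, ?_⟩) ?_
    · constructor <;> simp [BWPc.Checked, BWPc.PassedDiff, BWPc.PassedSame]
    · constructor <;> simp [hq, BWPc.pick, BWPc.Accounts, l2]
      grind
    · intro a b c ha hb hc
      by_cases hap : a = p
      · simp [hap, BWPc.seen]
      · by_cases hbp : b = p
        · subst hbp
          simp [HasColor, BWPc.pick, l2] at hb
          exact absurd hb.symm hc
        · simpa [hap] using h.blocker a b c (by simpa [HasColor, hap] using ha)
            (by simpa [HasColor, hbp] using hb) hc
  case h_5 s c k m hpc =>
    rw [hpc] at hl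
    have hcol : ∀ pc' : BWPc, pc'.pick = some c → ∀ q c',
        HasColor { st with pc := Function.update st.pc p pc' } q c' ↔ st.HasColor q c' := by
      intro pc' hpc' q c'
      by_cases hq : q = p
      · subst hq
        simp only [HasColor, Function.update_self, hpc, hpc']
        rfl
      · simp [HasColor, hq]
    obtain ⟨l1, l2, l3⟩ := hl
    split at hst
    case isTrue hk =>
      generalize hm' : (if (st.token ⟨k, hk⟩).color = some c ∧
        (st.token ⟨k, hk⟩).session ≠ 0 ∧ (st.token ⟨k, hk⟩).session ≠ s
        then max m (st.token ⟨k, hk⟩).number else m) = m' at hst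
      subst hst
      have hmm' : m ≤ m' := by
        rw [← hm']
        split_ifs
        · exact le_max_left _ _
        · exact le_rfl
      refine h.of_local p rfl (fun q hq => by simp [hq]) (by simp [BWPc.Local, l1, l2, l3])
        (fun q hq => ⟨?_, ?_⟩) ?_
      · constructor <;> simp [BWPc.Checked, BWPc.PassedDiff, BWPc.PassedSame]
      · obtain ⟨h1, h2, h3, h4⟩ := h.prec q p
        rw [hpc] at h1 h2
        constructor <;> simp only [ne_eq, hq, not_false_eq_true, Function.update_of_ne,
          Function.update_self]
        · exact h1
        · intro a b c' hc hc' hqk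
          have h5 := h2 a b c' hc hc'
          rcases Nat.lt_or_eq_of_le (Nat.le_of_lt_succ hqk) with hqk | hqk
          · exact (h5 hqk).trans hmm'
          · have hqe : (⟨k, hk⟩ : Fin N) = q := Fin.ext hqk.symm
            have h0 := (h.loc q).session_ne_zero_of_color (by simp [hc])
            rw [hqe] at hm'
            simp [BWPc.pick] at hc'
            rw [if_pos ⟨by rw [hc, hc'], h0, by simpa [l2] using b⟩] at hm'
            omega
        · exact h3
        · exact h4
      · intro a b c' ha hb hc hs h1
        rw [hcol _ rfl] at ha hb
        by_cases hap : a = p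
        · subst hap
          simp [BWPc.seen] at h1 ⊢
          have hg : c = st.gcolor := by simpa [HasColor, hpc, l2, BWPc.pick] using ha
          by_cases hm1 : 1 ≤ m
          · obtain ⟨l, hl1, hl2, hl3⟩ := h.blocker a b c' ha hb hc hs
              (by simpa [hpc, BWPc.seen] using hm1)
            rw [hpc] at hl3
            exact ⟨l, hl1, hl2, hl3.trans hmm'⟩
          · refine ⟨⟨k, hk⟩, ?_⟩
            split_ifs at hm' with hcond
            · exact ⟨hg ▸ hcond.1, by simpa [l2] using hcond.2.2, by omega⟩
            · omega
        · simpa [hap] using h.blocker a b c' ha hb hc hs (by simpa [hap] using h1)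
    case isFalse hk =>
      subst hst
      refine h.of_local p rfl (fun q hq => by simp [hq]) (by simp [BWPc.Local, l1, l2, l3])
        (fun q hq => ⟨?_, ?_⟩) ?_
      · constructor <;> simp [BWPc.Checked, BWPc.PassedDiff, BWPc.PassedSame]
      · obtain ⟨h1, h2, h3, h4⟩ := h.prec q p
        rw [hpc] at h1 h2
        constructor <;> simp only [ne_eq, hq, not_false_eq_true, Function.update_of_ne,
          Function.update_self]
        · exact h1
        · intro a b c' hc hc'
          exact Nat.lt_succ_of_le (h2 a b c' hc hc' (q.isLt.trans_le (not_lt.1 hk)))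
        · exact h3
        · exact h4
      · refine h.blocker.congr rfl (fun q c' => (hcol _ rfl q c').1) (fun _ _ _ => rfl)
          (fun q _ _ => ?_) (fun _ _ _ => rfl)
        by_cases hq : q = p
        · subst hq
          simp [hpc, BWPc.seen]
        · simp [hq]
  case h_6 s c m hpc =>
    rw [hpc] at hl
    obtain ⟨l1, l2, l3, l4⟩ := hl
    subst hst
    refine h.of_local p rfl (fun q hq => by simp [hq]) (by simp [BWPc.Local, l1, l3, l4])
      (fun q hq => ⟨?_, ?_⟩) ?_
    · constructor <;> simp [BWPc.Checked, BWPc.PassedDiff, BWPc.PassedSame]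
    · obtain ⟨h1, h2, h3, h4⟩ := h.prec q p
      rw [hpc] at h1 h2
      constructor <;> simp only [ne_eq, hq, not_false_eq_true, Function.update_of_ne,
        Function.update_self]
      · simp [BWPc.pick]
      · simp [BWPc.pick]
      · intro a b c₁ c₂ hc₁ hc₂
        exact h1 a.checked (by simpa [l2] using b) c₁ c₂ hc₁ hc₂
      · intro a b c₁ hc₁ hc₂
        exact .inl (h2 a.checked (by simpa [l2] using b) c₁ hc₁ hc₂)
    · refine h.blocker.congr rfl ?_ ?_ ?_ ?_ <;> intro q <;> by_cases hq : q = p <;>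
        simp_all [HasColor, BWPc.pick, BWPc.seen]
  case h_7 s c m hpc =>
    rw [hpc] at hl
    obtain ⟨l1, l2, l3, l4⟩ := hl
    subst hst
    refine h.of_local p rfl (fun q hq => by simp [hq]) (by simp [BWPc.Local, l1, l2, l4])
      (fun q hq => ⟨?_, ?_⟩) ?_
    · constructor <;> simp [BWPc.Checked, BWPc.PassedDiff, BWPc.PassedSame]
    · obtain ⟨h1, h2, h3, h4⟩ := h.prec q p
      constructor <;> simp only [ne_eq, hq, not_false_eq_true, Function.update_of_ne,
        Function.update_self]
      · simp [BWPc.pick]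
      · simp [BWPc.pick]
      · exact h3
      · exact h4
    · refine h.blocker.congr rfl ?_ ?_ ?_ ?_ <;> intro q <;> by_cases hq : q = p <;>
        simp_all [HasColor, BWPc.pick, BWPc.seen]
  case h_8 s c m k hpc =>
    rw [hpc] at hl
    split_ifs at hst with hk hch
    · subst hst
      refine h.of_pc p _ hl (by rw [hpc]; rfl) (by simp [BWPc.Accounts]) (by rw [hpc]; rfl)
        (fun q hq => ?_) (fun q hq => ?_) (fun q hq => ?_) <;> rw [hpc]
      · rcases Nat.lt_or_eq_of_le hq with hq | rfl
        · exact .inl hq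
        · refine .inr fun hs => ?_
          rcases hch with hch | hch
          · exact (h.loc q).pick_eq_none_of_not_choosing hch
          · simp_all [BWPc.Local]
      · exact .inl hq
      · exact .inl hq
    · subst hst
      exact h
    · subst hst
      refine h.of_pc p _ hl (by rw [hpc]; rfl) (by simp [BWPc.Accounts]) (by rw [hpc]; rfl)
        (fun q hq => ?_) (fun q hq => ?_) (fun q hq => ?_) <;> rw [hpc] <;>
        exact .inl (q.isLt.trans_le (not_lt.1 hk))
  case h_9 s c m k hpc =>
    rw [hpc] at hl
    split_ifs at hst with hk hc
    · subst hst
      refine h.of_pc p _ hl (by rw [hpc]; rfl) (by simp [BWPc.Accounts]) (by rw [hpc]; rfl)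
        (fun q hq => ?_) (fun q hq => ?_) (fun q hq => ?_) <;> rw [hpc]
      · exact .inl hq
      · rcases Nat.lt_or_eq_of_le hq with hq | rfl
        · exact .inl hq
        · refine .inr ?_
          simp_all [BWPc.Local]
      · exact .inl hq
    · subst hst
      refine h.of_pc p _ hl (by rw [hpc]; rfl) (by simp [BWPc.Accounts]) (by rw [hpc]; rfl)
        (fun q hq => ?_) (fun q hq => ?_) (fun q hq => ?_) <;> rw [hpc]
      · exact .inl hq
      · exact .inl hq
      · rcases Nat.lt_or_eq_of_le hq with hq | rfl
        · exact .inl hq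
        · refine .inr ?_
          simp_all [BWPc.Local]
    · subst hst
      exact h
  case h_10 s c m k hpc =>
    rw [hpc] at hl
    split_ifs at hst with hk hc
    · subst hst
      refine h.of_pc p _ hl (by rw [hpc]; rfl) (by simp [BWPc.Accounts]) (by rw [hpc]; rfl)
        (fun q hq => ?_) (fun q hq => ?_) (fun q hq => ?_) <;> rw [hpc]
      · exact .inl (Nat.le_of_lt_succ hq)
      · exact .inl (Nat.le_of_lt_succ hq)
      · rcases Nat.lt_or_eq_of_le (Nat.le_of_lt_succ hq) with hq | rfl
        · exact .inl hq
        · refine .inr fun hs c' hc1 hc2 => ?_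
          have := (h.loc q).session_ne_zero_of_color (by simp [hc2])
          grind [BWPc.Local]
    · subst hst
      exact h
    · subst hst
      exact h
  case h_11 s c m k hpc =>
    rw [hpc] at hl
    split_ifs at hst with hk hc
    · subst hst
      refine h.of_pc p _ hl (by rw [hpc]; rfl) (by simp [BWPc.Accounts]) (by rw [hpc]; rfl)
        (fun q hq => ?_) (fun q hq => ?_) (fun q hq => ?_) <;> rw [hpc]
      · exact .inl (Nat.le_of_lt_succ hq)
      · rcases Nat.lt_or_eq_of_le (Nat.le_of_lt_succ hq) with hq | rfl
        · exact .inl hq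
        · refine .inr fun hs c' c'' hc1 hc2 => ?_
          have := (h.loc q).session_ne_zero_of_color (by simp [hc2])
          grind [BWPc.Local]
      · exact .inl (Nat.le_of_lt_succ hq)
    · subst hst
      exact h
    · subst hst
      exact h
  case h_12 s c m hpc =>
    rw [hpc] at hl
    obtain ⟨l1, l2, l3, l4⟩ := hl
    rcases hst with rfl | rfl
    · exact h
    · split_ifs with hm <;>
      refine h.of_pc p _ ?_ (by rw [hpc]; rfl) (by simp [BWPc.Accounts]) (by rw [hpc]; rfl)
        (fun q hq => ?_) (fun q hq => ?_) (fun q hq => ?_) <;> (try rw [hpc])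
      all_goals first | exact .inl trivial | skip
      · simp_all [BWPc.Local]
      · exact ⟨l1, l2, l3, by omega⟩
  case h_13 s c m k hpc =>
    rw [hpc] at hl
    split_ifs at hst with hk hc <;> subst hst <;>
      refine h.of_pc p _ ?_ (by rw [hpc]; rfl) (by simp [BWPc.Accounts]) (by rw [hpc]; rfl)
        (fun q hq => ?_) (fun q hq => ?_) (fun q hq => ?_) <;> (try rw [hpc])
    all_goals first | exact .inl trivial | exact hl | skip
    simp_all [BWPc.Local]
  case h_14 s c m hpc =>
    rw [hpc] at hl
    obtain ⟨l1, l2, l3, l4⟩ := hl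
    subst hst
    have h1 : ({ st with pc := Function.update st.pc p .x2 } : BWState N).Inv := by
      refine h.of_pc p _ (by simp [BWPc.Local, l1, l2, l3]) (by rw [hpc]; rfl)
        (by simp [BWPc.Accounts]) (by rw [hpc]; rfl) (fun q _ => ?_) (fun q _ => ?_)
        (fun q _ => ?_) <;> rw [hpc] <;> exact .inl trivial
    have hop : c = st.gcolor ∨ c.opp = st.gcolor := by
      cases c <;> cases st.gcolor <;> simp [Color.opp]
    rcases hop with hg | hg
    · refine h1.of_gcolor st.gcolor c.opp fun i c' hi => ?_
      refine h.hasColor_eq (p := p) (i := i) ?_ ?_ ?_ (by rw [l2, hg]) (by rw [hpc]; rfl)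
        (by rwa [l2]) ?_
      · exact fun _ => by rw [hpc]; trivial
      · exact fun _ => by rw [hpc]; trivial
      · exact fun _ => by rw [hpc]; trivial
      · by_cases hip : i = p
        · subst hip
          simpa [HasColor, BWPc.pick, hpc] using hi
        · simpa [HasColor, hip] using hi
    · rw [hg]
      exact h1
  case h_15 hpc =>
    rw [hpc] at hl
    obtain ⟨l1, l2, l3⟩ := hl
    subst hst
    refine h.of_local p rfl (fun q hq => by simp [hq]) (by simp [BWPc.Local, l3])
      (fun q hq => ⟨?_, ?_⟩) ?_
    · constructor <;> simp [BWPc.Checked, BWPc.PassedDiff, BWPc.PassedSame]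
    · constructor <;> simp [hq, BWPc.pick, BWTok.init]
    · intro a b c ha hb hc hs h1
      have hne : ∀ q c, HasColor { st with
          token := Function.update st.token p BWTok.init,
          pc := Function.update st.pc p .remainder } q c → q ≠ p := by
        rintro q c hq rfl
        simp [HasColor, BWPc.pick, BWTok.init] at hq
      have hap := hne a _ ha
      have hbp := hne b _ hb
      simp [HasColor, hap, hbp] at ha hb hs h1 hc ⊢
      obtain ⟨l, hl1, hl2, hl3⟩ := h.blocker a b c ha hb hc hs h1
      have hlp : l ≠ p := by
        rintro rfl
        obtain ⟨h1, h2, h3, h4⟩ := h.prec l b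
        rw [hpc] at h1 h3
        rcases hb with hb | hb
        · exact h1 trivial (by rwa [hs]) _ _ hl1 hb (Ne.symm hc) rfl
        · exact h3 trivial (by rwa [hs]) _ _ hl1 hb (Ne.symm hc) rfl
      exact ⟨l, by simpa [hlp] using ⟨hl1, hl2, hl3⟩⟩

end BWState

theorem BWExec.inv {N : ℕ} (e : BWExec N) (n : ℕ) : (e.state n).Inv := by
  induction n with
  | zero =>
    obtain ⟨c, hc⟩ := e.init
    exact hc ▸ BWState.inv_bwInit c
  | succ n ih => exact ih.step (e.step n)

/-- **Mutual exclusion for the BWBGME algorithm.**  In every reachable state of every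
execution, no two processes requesting different sessions are simultaneously in the
critical section. -/
theorem bw_mutual_exclusion {N : ℕ} (e : BWExec N) (n : ℕ) (i j : Fin N)
    (si sj : ℕ) (ci cj : Color) (mi mj : ℕ)
    (hi : (e.state n).pc i = BWPc.cs si ci mi)
    (hj : (e.state n).pc j = BWPc.cs sj cj mj)
    (hs : si ≠ sj) : False := by
  have h := e.inv n
  have hli := h.loc i
  have hlj := h.loc j
  have hij := h.prec i j
  have hji := h.prec j i
  rw [hi] at hli
  rw [hj] at hlj
  obtain ⟨-, hti, -⟩ := hli
  obtain ⟨-, htj, -⟩ := hlj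
  by_cases hc : ci = cj
  · have h1 := hij.token_same (by rw [hi]; trivial) (by simpa [hti, htj] using hs) ci
      (by rw [hti]) (by rw [htj, hc])
    have h2 := hji.token_same (by rw [hj]; trivial) (by simpa [hti, htj] using hs.symm) ci
      (by rw [htj, hc]) (by rw [hti])
    omega
  · have h1 := hij.token_diff (by rw [hi]; trivial) (by simpa [hti, htj] using hs) ci cj
      (by rw [hti]) (by rw [htj]) hc
    have h2 := hji.token_diff (by rw [hj]; trivial) (by simpa [hti, htj] using hs.symm) cj ci
      (by rw [htj]) (by rw [hti]) (Ne.symm hc)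
    revert h1 h2 hc
    cases ci <;> cases cj <;> cases (e.state n).gcolor <;> simp
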